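/- arXiv:1704.03389 — 4 statements merged into one kernel-verified Lean document; each statement's English description precedes it below -/
import Mathlib

section
/- Let G be a finite group, V a finite-dimensional complex representation of G, and k a natural number. Then the class function g ↦ χ_V(g^k) is a virtual character: there exist finite-dimensional complex representations V₁ and V₂ of G such that χ_V(g^k) = χ_{V₁}(g) − χ_{V₂}(g) for all g ∈ G. Equivalently, Ψ^k(χ_V) lies in the ℤ-span of the irreducible characters of G. -/
namespace AdamsAux

/-- The ring of virtual characters. -/
def virt (G : Type) [Group G] : Subring (G → ℂ) where
  carrier := {f | ∃ V₁ V₂ : FDRep ℂ G, ∀ g, f g = V₁.character g - V₂.character g}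
  zero_mem' := ⟨FDRep.of (1 : Representation ℂ G ℂ), FDRep.of (1 : Representation ℂ G ℂ),
    fun g => by simp⟩
  one_mem' := ⟨FDRep.of (1 : Representation ℂ G ℂ), FDRep.of (1 : Representation ℂ G PUnit),
    fun g => by
      have h1 : (FDRep.of (1 : Representation ℂ G ℂ)).character g = 1 := by
        change LinearMap.trace ℂ ℂ 1 = 1
        simp
      have h2 : (FDRep.of (1 : Representation ℂ G PUnit)).character g = 0 := by
        change LinearMap.trace ℂ PUnit 1 = 0
        rw [Subsingleton.elim (1 : PUnit →ₗ[ℂ] PUnit) 0, map_zero]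
      rw [h1, h2]; simp⟩
  add_mem' := by
    rintro a b ⟨A, B, h⟩ ⟨C, D, h'⟩
    refine ⟨FDRep.of (Representation.prod A.ρ C.ρ), FDRep.of (Representation.prod B.ρ D.ρ), fun g => ?_⟩
    have key (X Y : FDRep ℂ G) : (FDRep.of (Representation.prod X.ρ Y.ρ)).character g
        = X.character g + Y.character g := LinearMap.trace_prodMap' (X.ρ g) (Y.ρ g)
    rw [key, key, Pi.add_apply, h, h']; ring
  neg_mem' := by
    rintro a ⟨A, B, h⟩
    exact ⟨B, A, fun g => by simp [h]⟩
  mul_mem' := by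
    rintro a b ⟨A, B, h⟩ ⟨C, D, h'⟩
    refine ⟨FDRep.of (Representation.prod (Representation.tprod A.ρ C.ρ) (Representation.tprod B.ρ D.ρ)),
      FDRep.of (Representation.prod (Representation.tprod A.ρ D.ρ) (Representation.tprod B.ρ C.ρ)), fun g => ?_⟩
    have key (X Y Z W : FDRep ℂ G) :
        (FDRep.of (Representation.prod (Representation.tprod X.ρ Y.ρ) (Representation.tprod Z.ρ W.ρ))).character g
        = X.character g * Y.character g + Z.character g * W.character g := by
      refine (LinearMap.trace_prodMap' _ _).trans ?_
      exact congrArg₂ (· + ·) (LinearMap.trace_tensorProduct' (X.ρ g) (Y.ρ g))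
        (LinearMap.trace_tensorProduct' (Z.ρ g) (W.ρ g))
    rw [key, key, Pi.mul_apply, h, h']; ring

/-- The exterior power of a representation. -/
noncomputable def ext {G : Type} [Group G] (V : FDRep ℂ G) (n : ℕ) :
    Representation ℂ G (⋀[ℂ]^n V) where
  toFun g := exteriorPower.map n (V.ρ g)
  map_one' := by rw [map_one]; exact exteriorPower.map_id
  map_mul' g h := by rw [map_mul]; exact exteriorPower.map_comp (V.ρ h) (V.ρ g)

theorem diag {V : Type} [AddCommGroup V] [Module ℂ V] [Module.Finite ℂ V]
    (T : V →ₗ[ℂ] V) (m : ℕ) (hm : m ≠ 0) (hT : T ^ m = 1) :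
    ∃ (d : ℕ) (b : Module.Basis (Fin d) ℂ V) (μ : Fin d → ℂ), ∀ i, T (b i) = μ i • b i := by
  have hss : Module.End.IsSemisimple T := by
    apply Module.End.isSemisimple_of_squarefree_aeval_eq_zero
      (p := Polynomial.X ^ m - Polynomial.C (1 : ℂ))
    · exact (Polynomial.separable_X_pow_sub_C (1 : ℂ) (by exact_mod_cast hm) one_ne_zero).squarefree
    · simp [hT]
  have htop := hss.iSup_eigenspace_eq_top
  let s : Set V := {v | ∃ μ : ℂ, T v = μ • v}
  have hs : ⊤ ≤ Submodule.span ℂ s := by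
    rw [← htop]
    refine iSup_le fun μ v hv => Submodule.subset_span ⟨μ, ?_⟩
    exact Module.End.mem_eigenspace_iff.1 hv
  let b := Module.Basis.ofSpan hs
  have hb : ∀ i, b i ∈ s := fun i => Module.Basis.ofSpan_subset hs ⟨i, rfl⟩
  have : Fintype ((linearIndepOn_empty ℂ id).extend (Set.empty_subset s)) :=
    FiniteDimensional.fintypeBasisIndex b
  choose μ hμ using hb
  let e := Fintype.equivFin ((linearIndepOn_empty ℂ id).extend (Set.empty_subset s))
  refine ⟨_, b.reindex e, fun i => μ (e.symm i), fun i => ?_⟩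
  simp [hμ]

theorem trace_diag {ι : Type} [Fintype ι] {V : Type} [AddCommGroup V] [Module ℂ V]
    (T : V →ₗ[ℂ] V) (b : Module.Basis ι ℂ V) (μ : ι → ℂ) (h : ∀ i, T (b i) = μ i • b i) :
    LinearMap.trace ℂ V T = ∑ i, μ i := by
  classical
  rw [LinearMap.trace_eq_matrix_trace ℂ b, Matrix.trace]
  refine Finset.sum_congr rfl fun i _ => ?_
  simp [LinearMap.toMatrix_apply, h]

theorem trace_ext {d : ℕ} {V : Type} [AddCommGroup V] [Module ℂ V]
    (T : V →ₗ[ℂ] V) (b : Module.Basis (Fin d) ℂ V) (μ : Fin d → ℂ)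
    (h : ∀ i, T (b i) = μ i • b i) (n : ℕ) :
    LinearMap.trace ℂ _ (exteriorPower.map n T) =
      MvPolynomial.aeval μ (MvPolynomial.esymm (Fin d) ℂ n) := by
  classical
  have : Fintype (Set.powersetCard (Fin d) n) := Fintype.ofFinite _
  rw [trace_diag _ (b.exteriorPower n) (fun s => ∏ i ∈ (s : Finset (Fin d)), μ i)]
  · simp only [MvPolynomial.esymm, map_sum, map_prod, MvPolynomial.aeval_X]
    symm
    apply Finset.sum_subtype
    intro x
    simp [Finset.mem_powersetCard]
  · intro s
    rw [exteriorPower.basis_apply, exteriorPower.map_apply_ιMulti_family]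
    have : T ∘ b = fun i => μ i • b i := funext h
    rw [this, exteriorPower.ιMulti_family, exteriorPower.ιMulti_family]
    refine ((exteriorPower.ιMulti ℂ n).map_smul_univ
      (fun i => μ (Set.powersetCard.ofFinEmbEquiv.symm s i))
      (fun i => b (Set.powersetCard.ofFinEmbEquiv.symm s i))).trans ?_
    congr 1
    rw [← Finset.prod_coe_sort s.1 μ, ← (Finset.orderIsoOfFin s.1 s.2).toEquiv.prod_comp]
    rfl

theorem trace_pow {d : ℕ} {V : Type} [AddCommGroup V] [Module ℂ V]
    (T : V →ₗ[ℂ] V) (b : Module.Basis (Fin d) ℂ V) (μ : Fin d → ℂ)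
    (h : ∀ i, T (b i) = μ i • b i) (n : ℕ) :
    LinearMap.trace ℂ _ (T ^ n) =
      MvPolynomial.aeval μ (MvPolynomial.psum (Fin d) ℂ n) := by
  rw [trace_diag _ b (fun i => μ i ^ n)]
  · simp [MvPolynomial.psum]
  · intro i
    induction n with
    | zero => simp
    | succ n ih => rw [pow_succ, Module.End.mul_apply, h, map_smul, ih, smul_smul, pow_succ']

theorem newton {G : Type} [Group G] [Fintype G] (V : FDRep ℂ G) (k : ℕ) (hk : 0 < k) :
    (fun g => V.character (g ^ k)) = (-1) ^ (k + 1) * (k : G → ℂ) * (FDRep.of (ext V k)).character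
      - ∑ a ∈ Finset.HasAntidiagonal.antidiagonal k with a.1 ∈ Set.Ioo 0 k,
        (-1) ^ a.1 * (FDRep.of (ext V a.1)).character * (fun g => V.character (g ^ a.2)) := by
  funext g
  obtain ⟨d, b, μ, h⟩ := diag (V.ρ g) (Fintype.card G) Fintype.card_ne_zero
    (by rw [← map_pow, pow_card_eq_one, map_one])
  have h1 (n : ℕ) : V.character (g ^ n) = MvPolynomial.aeval μ (MvPolynomial.psum (Fin d) ℂ n) := by
    rw [← trace_pow _ b μ h, ← map_pow]; rfl
  have h2 (n : ℕ) : (FDRep.of (ext V n)).character g =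
      MvPolynomial.aeval μ (MvPolynomial.esymm (Fin d) ℂ n) := trace_ext _ b μ h n
  have := congrArg (MvPolynomial.aeval μ) (MvPolynomial.psum_eq_mul_esymm_sub_sum (Fin d) ℂ k hk)
  simp only [Pi.sub_apply, Pi.mul_apply, Finset.sum_apply, h1, h2, this, map_sub, map_sum, map_mul,
    map_pow, map_neg, map_one, map_natCast, Pi.pow_apply, Pi.neg_apply, Pi.one_apply,
    Pi.natCast_apply]

theorem char_mem {G : Type} [Group G] (V : FDRep ℂ G) : V.character ∈ virt G :=
  ⟨V, FDRep.of (1 : Representation ℂ G PUnit), fun g => by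
      have h2 : (FDRep.of (1 : Representation ℂ G PUnit)).character g = 0 := by
        change LinearMap.trace ℂ PUnit 1 = 0
        rw [Subsingleton.elim (1 : PUnit →ₗ[ℂ] PUnit) 0, map_zero]
      rw [h2, sub_zero]⟩

theorem adams_mem {G : Type} [Group G] [Fintype G] (V : FDRep ℂ G) (k : ℕ) :
    (fun g => V.character (g ^ k)) ∈ virt G := by
  induction k using Nat.strong_induction_on with
  | _ k ih =>
    rcases Nat.eq_zero_or_pos k with rfl | hk
    · have : (fun g : G => V.character (g ^ 0)) = ((Module.finrank ℂ V : ℕ) : G → ℂ) := by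
        funext g
        rw [pow_zero, FDRep.char_one]; rfl
      rw [this]
      exact natCast_mem _ _
    · rw [newton V k hk]
      have hneg (n : ℕ) : (-1 : G → ℂ) ^ n ∈ virt G := pow_mem (neg_mem (one_mem _)) _
      refine sub_mem (mul_mem (mul_mem (hneg _) (natCast_mem _ _)) (char_mem _))
        (sum_mem fun a ha => mul_mem (mul_mem (hneg _) (char_mem _)) (ih _ ?_))
      simp only [Finset.mem_filter, Finset.HasAntidiagonal.mem_antidiagonal, Set.mem_Ioo] at ha
      omega

end AdamsAux

/-- The class function `g ↦ χ_V(g^k)` (the `k`-th Adams operation applied to the character of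
`V`) is a virtual character: a difference of two characters. -/
theorem adams_operation_is_virtual_character
    {G : Type} [Group G] [Fintype G] (V : FDRep ℂ G) (k : ℕ) :
    ∃ V₁ V₂ : FDRep ℂ G, ∀ g : G, V.character (g ^ k) = V₁.character g - V₂.character g :=
  AdamsAux.adams_mem V k
end

section
/- Let G and G' be finite groups. Let R(G) denote the subring of the ring of complex-valued functions on G (with pointwise operations) generated by the characters of all finite-dimensional complex representations of G, and similarly for R(G'). If R(G) and R(G') are isomorphic as rings, then |G| = |G'|. -/
open CategoryTheory in
theorem RepRing.char_split {G : Type} [Group G] {V : Type} [AddCommGroup V] [Module ℂ V]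
    [FiniteDimensional ℂ V] (ρ : Representation ℂ G V) (A B : Subrepresentation ρ)
    (h : IsCompl A B) (g : G) :
    LinearMap.trace ℂ V (ρ g) = LinearMap.trace ℂ A.toSubmodule (A.toRepresentation g) +
      LinearMap.trace ℂ B.toSubmodule (B.toRepresentation g) := by
  have hc : IsCompl A.toSubmodule B.toSubmodule := by
    constructor
    · rw [disjoint_iff, ← Subrepresentation.toSubmodule_inf, h.inf_eq_bot]; rfl
    · rw [codisjoint_iff, ← Subrepresentation.toSubmodule_sup, h.sup_eq_top]; rfl
  have h2 := (DirectSum.isInternal_submodule_iff_isCompl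
    (fun b : Bool => (bif b then A.toSubmodule else B.toSubmodule)) (i := true) (j := false)
    (by decide) (by ext b; cases b <;> simp)).2 hc
  have := LinearMap.trace_eq_sum_trace_restrict h2 (f := ρ g) (by
    intro b
    cases b
    · exact B.apply_mem_toSubmodule g
    · exact A.apply_mem_toSubmodule g)
  rw [this, Fintype.sum_bool]
  rfl

/-- Irreducible characters. -/
def RepRing.irr (G : Type) [Group G] : Set (G → ℂ) :=
  {f | ∃ V : FDRep ℂ G, Representation.IsIrreducible V.ρ ∧ f = V.character}

theorem RepRing.char_mem_span_aux {G : Type} [Group G] [Fintype G] (n : ℕ) :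
    ∀ (V : Type) [AddCommGroup V] [Module ℂ V] [FiniteDimensional ℂ V]
      (ρ : Representation ℂ G V), Module.finrank ℂ V = n →
      (fun g => LinearMap.trace ℂ V (ρ g)) ∈ Submodule.span ℤ (RepRing.irr G) := by
  induction n using Nat.strong_induction_on with
  | _ n ih =>
  intro V _ _ _ ρ hn
  by_cases hirr : Representation.IsIrreducible ρ
  · exact Submodule.subset_span ⟨FDRep.of ρ, hirr, rfl⟩
  by_cases hnt : Nontrivial V
  · have : ∃ A : Subrepresentation ρ, A ≠ ⊥ ∧ A ≠ ⊤ := by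
      by_contra! hcon
      apply hirr
      have : Nontrivial (Subrepresentation ρ) := by
        refine ⟨⊥, ⊤, fun hb => ?_⟩
        have : (⊥ : Submodule ℂ V) = ⊤ := congrArg Subrepresentation.toSubmodule hb
        exact bot_ne_top this
      exact ⟨fun A => or_iff_not_imp_left.2 (hcon A)⟩
    obtain ⟨A, hA1, hA2⟩ := this
    obtain ⟨B, hB⟩ := exists_isCompl A
    have lt : ∀ C : Subrepresentation ρ, C ≠ ⊤ → Module.finrank ℂ C.toSubmodule < n := by
      intro C hC
      rw [← hn]
      apply Submodule.finrank_lt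
      intro h
      exact hC (Subrepresentation.toSubmodule_injective h)
    have hB2 : B ≠ ⊤ := by
      rintro rfl
      exact hA1 (by simpa using hB.inf_eq_bot)
    have e : (fun g => LinearMap.trace ℂ V (ρ g)) =
        (fun g => LinearMap.trace ℂ A.toSubmodule (A.toRepresentation g)) +
        (fun g => LinearMap.trace ℂ B.toSubmodule (B.toRepresentation g)) := by
      ext g
      exact RepRing.char_split ρ A B hB g
    rw [e]
    exact add_mem (ih _ (lt A hA2) _ A.toRepresentation rfl)
      (ih _ (lt B hB2) _ B.toRepresentation rfl)
  · rw [not_nontrivial_iff_subsingleton] at hnt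
    have : (fun g => LinearMap.trace ℂ V (ρ g)) = 0 := by
      ext g
      have : ρ g = 0 := Subsingleton.elim _ _
      simp [this]
    rw [this]
    exact zero_mem _

/-- The representation ring. -/
abbrev RepRing.R (G : Type) [Group G] : Subring (G → ℂ) :=
  Subring.closure {f : G → ℂ | ∃ V : FDRep ℂ G, f = V.character}

theorem RepRing.char_mem {G : Type} [Group G] (V : FDRep ℂ G) : V.character ∈ RepRing.R G :=
  Subring.subset_closure ⟨V, rfl⟩

theorem RepRing.trivial_char {G : Type} [Group G] :
    (1 : G → ℂ) = (FDRep.of (Representation.trivial ℂ G ℂ)).character := by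
  ext g
  change (1 : ℂ) = LinearMap.trace ℂ ℂ (LinearMap.id)
  simp

theorem RepRing.induct {G : Type} [Group G] (P : AddSubgroup (G → ℂ))
    (h : ∀ V : FDRep ℂ G, V.character ∈ P) (f : G → ℂ) (hf : f ∈ RepRing.R G) : f ∈ P := by
  rw [Subring.mem_closure_iff] at hf
  refine (AddSubgroup.closure_le P).2 ?_ hf
  intro x hx
  have : ∃ V : FDRep ℂ G, x = V.character := by
    refine Submonoid.closure_induction (motive := fun x _ => ∃ V : FDRep ℂ G, x = V.character)
      (fun x hx => hx) ⟨_, RepRing.trivial_char⟩ ?_ hx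
    rintro _ _ _ _ ⟨V, rfl⟩ ⟨W, rfl⟩
    exact ⟨CategoryTheory.MonoidalCategoryStruct.tensorObj V W, (FDRep.char_tensor V W).symm⟩
  obtain ⟨V, rfl⟩ := this
  exact h V

theorem RepRing.mem_span {G : Type} [Group G] [Fintype G] (f : G → ℂ) (hf : f ∈ RepRing.R G) :
    f ∈ Submodule.span ℤ (RepRing.irr G) :=
  RepRing.induct (Submodule.span ℤ (RepRing.irr G)).toAddSubgroup
    (fun V => RepRing.char_mem_span_aux _ V V.ρ rfl) f hf

theorem RepRing.one_int {G : Type} [Group G] (f : G → ℂ) (hf : f ∈ RepRing.R G) :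
    ∃ k : ℤ, f 1 = k := by
  have := RepRing.induct (((Int.castAddHom ℂ).range).comap (Pi.evalAddMonoidHom (fun _ : G => ℂ) 1))
    (fun V => ⟨Module.finrank ℂ V, by simp⟩) f hf
  obtain ⟨k, hk⟩ := this
  exact ⟨k, hk.symm⟩

theorem RepRing.avg_int {G : Type} [Group G] [Fintype G] (f : G → ℂ) (hf : f ∈ RepRing.R G) :
    ∃ k : ℤ, (Nat.card G : ℂ)⁻¹ * ∑ g, f g = k := by
  have hc : (Nat.card G : ℂ) ≠ 0 := by exact_mod_cast Nat.card_pos.ne'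
  let _ : Invertible (Nat.card G : ℂ) := invertibleOfNonzero hc
  let L : (G → ℂ) →+ ℂ :=
    { toFun := fun f => (Nat.card G : ℂ)⁻¹ * ∑ g, f g
      map_zero' := by simp
      map_add' := fun a b => by simp [Finset.sum_add_distrib, mul_add] }
  have := RepRing.induct (((Int.castAddHom ℂ).range).comap L)
    (fun V => ⟨Module.finrank ℂ (Representation.invariants V.ρ), by
      have h := (FDRep.average_char_eq_finrank_invariants V).symm
      change (((Module.finrank ℂ (Representation.invariants V.ρ) : ℕ) : ℤ) : ℂ) = _
      rw [Int.cast_natCast]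
      exact h⟩) f hf
  obtain ⟨k, hk⟩ := this
  exact ⟨k, hk.symm⟩

open Classical in
theorem RepRing.reg_mem {G : Type} [Group G] [Fintype G] :
    (Pi.single 1 (Nat.card G : ℂ) : G → ℂ) ∈ RepRing.R G := by
  let ρ : Representation ℂ G (G → ℂ) :=
    { toFun := fun g => LinearMap.funLeft ℂ ℂ (fun x => x * g)
      map_one' := by ext; simp
      map_mul' := fun a b => by ext; simp [LinearMap.funLeft_apply, mul_assoc, Pi.single_apply] }
  refine Subring.subset_closure ⟨FDRep.of ρ, ?_⟩
  ext g
  change _ = LinearMap.trace ℂ (G → ℂ) (ρ g)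
  rw [LinearMap.trace_eq_matrix_trace ℂ (Pi.basisFun ℂ G), Matrix.trace]
  simp only [Matrix.diag_apply, LinearMap.toMatrix_apply, Pi.basisFun_repr, Pi.basisFun_apply]
  change _ = ∑ i : G, (Pi.single i (1 : ℂ) : G → ℂ) (i * g)
  by_cases hg : g = 1
  · subst hg; simp
  · simp [hg, Pi.single_apply]

theorem RepRing.bound {G : Type} [Group G] [Fintype G] (x : RepRing.R G) (n : ℕ) (hx : x ≠ 0)
    (hxx : x * x = (n : ℤ) • x) (hr : ∀ r : RepRing.R G, ∃ k : ℤ, r * x = k • x)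
    (hp : ∀ (m : ℤ) (y : RepRing.R G), x = m • y → m.natAbs = 1) : n ≤ Fintype.card G := by
  classical
  have hc : (Nat.card G : ℂ) ≠ 0 := by exact_mod_cast Nat.card_pos.ne'
  let _ : Invertible (Nat.card G : ℂ) := invertibleOfNonzero hc
  obtain ⟨x, hxR⟩ := x
  obtain ⟨c, hcx⟩ := RepRing.avg_int x hxR
  obtain ⟨m, hm, hmx⟩ := Submodule.mem_span_set.1 (RepRing.mem_span x hxR)
  have key : ∀ χ ∈ RepRing.irr G, ∃ k : ℤ, m χ = k * c := by
    rintro χ ⟨V, hV, rfl⟩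
    obtain ⟨k, hk⟩ := hr ⟨_, RepRing.char_mem (FDRep.of (Representation.dual V.ρ))⟩
    refine ⟨k, ?_⟩
    have hk' : ∀ g, V.character g⁻¹ * x g = k * x g := by
      intro g
      have := congrFun (congrArg Subtype.val hk) g
      simpa using this
    have h1 : (Nat.card G : ℂ)⁻¹ * ∑ g, x g * V.character g⁻¹ = k * c := by
      rw [← hcx, mul_left_comm]
      congr 1
      rw [Finset.mul_sum]
      exact Finset.sum_congr rfl fun g _ => by rw [mul_comm, hk']
    have h2 : (Nat.card G : ℂ)⁻¹ * ∑ g, x g * V.character g⁻¹ = m V.character := by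
      have horth : ∀ ψ ∈ RepRing.irr G, (Nat.card G : ℂ)⁻¹ * ∑ g, ψ g * V.character g⁻¹ =
          if ψ = V.character then 1 else 0 := by
        rintro ψ ⟨W, hW, rfl⟩
        have := Representation.char_orthonormal W.ρ V.ρ
        refine this.trans ?_
        by_cases hE : W.character = V.character
        · rw [if_pos hE]
          rw [← this]
          have h3 := Representation.char_orthonormal V.ρ V.ρ
          rw [if_pos ⟨Representation.Equiv.refl _⟩] at h3
          change (Nat.card G : ℂ)⁻¹ * ∑ g, W.character g * V.character g⁻¹ = 1
          rw [hE]
          exact_mod_cast h3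
        · rw [if_neg hE, if_neg]
          · rintro ⟨φ⟩
            exact hE (Representation.char_iso φ).symm
      rw [← hmx]
      simp only [Finsupp.sum, Finset.sum_apply, Pi.smul_apply, Finset.sum_mul]
      simp only [zsmul_eq_mul]
      rw [Finset.sum_comm, Finset.mul_sum]
      have : ∀ ψ ∈ m.support, (Nat.card G : ℂ)⁻¹ * ∑ g, (m ψ : ℂ) * ψ g * V.character g⁻¹ =
          if ψ = V.character then (m ψ : ℂ) else 0 := by
        intro ψ hψ
        have := horth ψ (hm hψ)
        simp only [mul_assoc]
        rw [← Finset.mul_sum, mul_left_comm, this]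
        simp
      rw [Finset.sum_congr rfl this]
      simp +contextual
    rw [h2] at h1
    exact_mod_cast h1
  choose! k hk using key
  have hy : (∑ χ ∈ m.support, k χ • χ) ∈ RepRing.R G := by
    refine sum_mem fun χ hχ => zsmul_mem ?_ _
    obtain ⟨V, -, rfl⟩ := hm hχ
    exact RepRing.char_mem V
  have hc1 := hp c ⟨_, hy⟩ (by
    apply Subtype.ext
    change x = c • ∑ χ ∈ m.support, k χ • χ
    rw [← hmx, Finsupp.sum, Finset.smul_sum]
    refine Finset.sum_congr rfl fun χ hχ => ?_
    rw [hk χ (hm hχ), smul_smul, mul_comm])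
  have hv : ∀ g, x g = if x g ≠ 0 then (n : ℂ) else 0 := by
    intro g
    have : x g * x g = n * x g := by
      simpa using congrFun (congrArg Subtype.val hxx) g
    by_cases h0 : x g = 0
    · simp [h0]
    · rw [if_pos h0]; exact mul_right_cancel₀ h0 this
  have hs : ∑ g, x g = ((Finset.univ.filter fun g => x g ≠ 0).card : ℂ) * n := by
    rw [Finset.sum_congr rfl fun g _ => hv g, ← Finset.sum_filter]
    simp
  have hne : ∃ g, x g ≠ 0 := by
    by_contra! h
    exact hx (Subtype.ext (funext h))
  obtain ⟨g, hg⟩ := hne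
  have hpos : 0 < (Finset.univ.filter fun g => x g ≠ 0).card :=
    Finset.card_pos.2 ⟨g, by simpa using hg⟩
  have h5 : ((Finset.univ.filter fun g => x g ≠ 0).card : ℂ) * n = Nat.card G * c := by
    rw [← hcx, ← hs, mul_inv_cancel_left₀ hc]
  have h6 : ((Finset.univ.filter fun g => x g ≠ 0).card : ℤ) * n = Nat.card G * c := by
    exact_mod_cast h5
  have h7 := congrArg Int.natAbs h6
  rw [Int.natAbs_mul, Int.natAbs_mul, hc1] at h7
  simp only [Int.natAbs_natCast, mul_one, Nat.card_eq_fintype_card] at h7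
  rw [← h7]
  exact Nat.le_mul_of_pos_left _ hpos

theorem RepRing.card_le {G G' : Type} [Group G] [Fintype G] [Group G'] [Fintype G']
    (e : RepRing.R G ≃+* RepRing.R G') : Fintype.card G ≤ Fintype.card G' := by
  classical
  have hc : (Nat.card G : ℂ) ≠ 0 := by exact_mod_cast Nat.card_pos.ne'
  let ρ : RepRing.R G := ⟨_, RepRing.reg_mem (G := G)⟩
  have hval : ∀ g, ρ.1 g = if g = 1 then (Nat.card G : ℂ) else 0 := by
    intro g
    simp [ρ, Pi.single_apply]
  refine RepRing.bound (e ρ) _ ?_ ?_ ?_ ?_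
  · rw [Ne, EmbeddingLike.map_eq_zero_iff]
    intro h
    have := congrFun (congrArg Subtype.val h) 1
    rw [hval] at this
    simp at this
  · rw [← map_mul, ← map_zsmul]
    congr 1
    apply Subtype.ext
    ext g
    change ρ.1 g * ρ.1 g = ((Fintype.card G : ℤ) • ρ.1) g
    rw [Pi.smul_apply, hval]
    by_cases hg : g = 1 <;> simp [hg]
  · intro r
    obtain ⟨r, rfl⟩ := e.surjective r
    obtain ⟨k, hk⟩ := RepRing.one_int r.1 r.2
    refine ⟨k, ?_⟩
    rw [← map_mul, ← map_zsmul]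
    congr 1
    apply Subtype.ext
    ext g
    change r.1 g * ρ.1 g = (k • ρ.1) g
    rw [Pi.smul_apply, hval]
    by_cases hg : g = 1 <;> simp [hg, hk]
  · intro m y hy
    obtain ⟨y, rfl⟩ := e.surjective y
    rw [← map_zsmul] at hy
    have hy := e.injective hy
    obtain ⟨k, hk⟩ := RepRing.avg_int y.1 y.2
    have h1 : (m : ℂ) * k = 1 := by
      rw [← hk, mul_left_comm, Finset.mul_sum]
      have : ∀ g, (m : ℂ) * y.1 g = if g = 1 then (Nat.card G : ℂ) else 0 := by
        intro g
        rw [← hval, hy]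
        simp
      simp only [this]
      simp
    have h2 : m * k = 1 := by exact_mod_cast h1
    exact Int.isUnit_iff_natAbs_eq.1 (IsUnit.of_mul_eq_one _ h2)

/-- If the representation rings of two finite groups, realized as the subrings of the rings of
complex-valued functions generated by the characters of finite-dimensional representations, are
isomorphic as rings, then the groups have the same order. -/
theorem card_eq_of_representationRing_iso
    {G G' : Type} [Group G] [Fintype G] [Group G'] [Fintype G']
    (e : Subring.closure {f : G → ℂ | ∃ V : FDRep ℂ G, f = V.character} ≃+*
        Subring.closure {f : G' → ℂ | ∃ V : FDRep ℂ G', f = V.character}) :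
    Fintype.card G = Fintype.card G' :=
  le_antisymm (RepRing.card_le e) (RepRing.card_le e.symm)
end

section
/- Let K be an algebraically closed field, M a finite commutative group, σ an automorphism of M, and α : M × M → Kˣ a function. Suppose there exists a function z₀ : M → Kˣ with z₀(φ)·z₀(ψ)·z₀(φψ)⁻¹ = α(σ(φ), σ(ψ))·α(φ, ψ)⁻¹ for all φ, ψ ∈ M. Then there exists a function z : M → Kˣ satisfying the same relation z(φ)·z(ψ)·z(φψ)⁻¹ = α(σ(φ), σ(ψ))·α(φ, ψ)⁻¹ for all φ, ψ ∈ M and, in addition, z(φ) = 1 for every φ ∈ M with σ(φ) = φ. -/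
/-- A hom from a subgroup to the units of an algebraically closed field extends. -/
theorem extend_hom_units {K : Type} [Field K] [IsAlgClosed K] {M : Type} [CommGroup M]
    (H : Subgroup M) (f : H →* Kˣ) : ∃ g : M →* Kˣ, ∀ x : H, g x = f x := by
  have hsurj : ∀ {n : ℕ}, n ≠ 0 →
      Function.Surjective (fun a : Additive Kˣ => n • a) := by
    intro n hn a
    obtain ⟨y, hy⟩ := IsAlgClosed.exists_pow_nat_eq
      ((Additive.toMul a : Kˣ) : K) (Nat.pos_of_ne_zero hn)
    have hy0 : y ≠ 0 := by
      rintro rfl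
      rw [zero_pow hn] at hy
      exact (Additive.toMul a).ne_zero hy.symm
    refine ⟨Additive.ofMul (Units.mk0 y hy0), ?_⟩
    apply Additive.toMul.injective
    apply Units.ext
    simpa using hy
  letI : DivisibleBy (Additive Kˣ) ℕ := divisibleByOfSMulRightSurj _ _ hsurj
  letI : DivisibleBy (Additive Kˣ) ℤ := AddGroup.divisibleByIntOfDivisibleByNat _
  have hB := Module.Baer.of_divisible (Additive Kˣ)
  obtain ⟨h, hh⟩ := Module.Baer.extension_property hB
    (MonoidHom.toAdditive H.subtype).toIntLinearMap
    (fun a b hab => Additive.toMul.injective (Subtype.ext (congrArg Additive.toMul hab)))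
    (MonoidHom.toAdditive f).toIntLinearMap
  refine ⟨MonoidHom.toAdditive.symm h.toAddMonoidHom, fun x => ?_⟩
  exact congrArg Additive.toMul (LinearMap.congr_fun hh (Additive.ofMul x))

/-- If `dz₀ = σ(α)/α` has a solution `z₀`, then there is a solution `z` which moreover takes the
value `1` on every `σ`-fixed point. -/
theorem exists_normalized_cochain
    {K : Type} [Field K] [IsAlgClosed K] {M : Type} [CommGroup M] [Finite M]
    (σ : M ≃* M) (α : M × M → Kˣ) (z₀ : M → Kˣ)
    (hz₀ : ∀ φ ψ : M, z₀ φ * z₀ ψ * (z₀ (φ * ψ))⁻¹ = α (σ φ, σ ψ) * (α (φ, ψ))⁻¹) :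
    ∃ z : M → Kˣ,
      (∀ φ ψ : M, z φ * z ψ * (z (φ * ψ))⁻¹ = α (σ φ, σ ψ) * (α (φ, ψ))⁻¹) ∧
        ∀ φ : M, σ φ = φ → z φ = 1 := by
  have hmul : ∀ φ ψ : M, σ φ = φ → σ ψ = ψ → z₀ (φ * ψ) = z₀ φ * z₀ ψ := by
    intro φ ψ h1 h2
    have h := hz₀ φ ψ
    rw [h1, h2, mul_inv_cancel] at h
    exact (mul_inv_eq_one.mp h).symm
  let H : Subgroup M :=
    { carrier := {φ | σ φ = φ}
      mul_mem' := by
        intro a b ha hb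
        simp only [Set.mem_setOf_eq] at *
        rw [map_mul, ha, hb]
      one_mem' := map_one σ
      inv_mem' := by
        intro a ha
        simp only [Set.mem_setOf_eq] at *
        rw [map_inv, ha] }
  let f : H →* Kˣ := MonoidHom.mk' (fun x => z₀ x) (fun a b => hmul a b a.2 b.2)
  obtain ⟨g, hg⟩ := extend_hom_units H f
  refine ⟨fun φ => z₀ φ * (g φ)⁻¹, fun φ ψ => ?_, fun φ hφ => ?_⟩
  · rw [← hz₀ φ ψ]
    simp only [map_mul, mul_inv, inv_inv]
    have : z₀ φ * (g φ)⁻¹ * (z₀ ψ * (g ψ)⁻¹) * ((z₀ (φ * ψ))⁻¹ * (g φ * g ψ)) =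
      z₀ φ * z₀ ψ * (z₀ (φ * ψ))⁻¹ * ((g φ)⁻¹ * g φ) * ((g ψ)⁻¹ * g ψ) := by
      ac_rfl
    rw [this, inv_mul_cancel, inv_mul_cancel, mul_one, mul_one]
  · have h : g φ = z₀ φ := hg ⟨φ, hφ⟩
    simp only [h, mul_inv_cancel]
end

section
/- Let M be a commutative group, σ an automorphism of M, A a commutative group, α : M × M → A a function, and z : M → A a function satisfying z(φ)·z(ψ)·z(φψ)⁻¹ = α(σ(φ), σ(ψ))·α(φ, ψ)⁻¹ for all φ, ψ ∈ M, and z(ψ) = 1 whenever σ(ψ) = ψ. Then for every k ≥ 1 and every φ ∈ M with σ^k(φ) = φ, the element a = ∏_{j=0}^{k-1} z(σ^j(φ)) satisfies a^k = 1. -/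
/-- If `dz = σ(α)/α` and `z` takes the value `1` on `σ`-fixed points, then for `σ^k`-fixed `φ`,
the element `a = ∏_{j<k} z(σ^j(φ))` satisfies `a^k = 1`. -/
theorem prod_z_pow_eq_one
    {M A : Type} [CommGroup M] [CommGroup A] (σ : MulAut M) (α : M × M → A) (z : M → A)
    (hz : ∀ φ ψ : M, z φ * z ψ * (z (φ * ψ))⁻¹ = α (σ φ, σ ψ) * (α (φ, ψ))⁻¹)
    (hfix : ∀ ψ : M, σ ψ = ψ → z ψ = 1)
    (k : ℕ) (hk : 1 ≤ k) (φ : M) (hφ : (σ ^ k) φ = φ) :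
    (∏ j ∈ Finset.range k, z ((σ ^ j) φ)) ^ k = 1 := by
  have hmul : ∀ x y : M, (σ ^ k) x = x → (σ ^ k) y = y →
      (∏ j ∈ Finset.range k, z ((σ ^ j) (x * y))) =
      (∏ j ∈ Finset.range k, z ((σ ^ j) x)) * ∏ j ∈ Finset.range k, z ((σ ^ j) y) := by
    intro x y hx hy
    have key : ∀ n : ℕ, (∏ j ∈ Finset.range n, z ((σ ^ j) x)) *
        (∏ j ∈ Finset.range n, z ((σ ^ j) y)) * (∏ j ∈ Finset.range n, z ((σ ^ j) (x * y)))⁻¹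
        = α ((σ ^ n) x, (σ ^ n) y) * (α (x, y))⁻¹ := by
      intro n
      rw [← Finset.prod_inv_distrib, ← Finset.prod_mul_distrib, ← Finset.prod_mul_distrib]
      induction n with
      | zero => simp
      | succ n ih =>
        rw [Finset.prod_range_succ, ih, map_mul, hz, pow_succ', MulAut.mul_apply,
          MulAut.mul_apply, mul_comm, mul_assoc, inv_mul_cancel_left]
    have h := key k
    rw [hx, hy, mul_inv_cancel] at h
    exact (mul_inv_eq_one.mp h).symm
  have hshift : ∀ f : ℕ → M, f k = f 0 →
      ∏ j ∈ Finset.range k, f (j + 1) = ∏ j ∈ Finset.range k, f j := by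
    intro f hf
    have h1 := Finset.prod_range_succ f k
    rw [Finset.prod_range_succ', hf] at h1
    exact mul_right_cancel h1
  have hshiftA : ∀ f : ℕ → A, f k = f 0 →
      ∏ j ∈ Finset.range k, f (j + 1) = ∏ j ∈ Finset.range k, f j := by
    intro f hf
    have h1 := Finset.prod_range_succ f k
    rw [Finset.prod_range_succ', hf] at h1
    exact mul_right_cancel h1
  have hfixpow : ∀ i : ℕ, (σ ^ k) ((σ ^ i) φ) = (σ ^ i) φ := by
    intro i
    rw [← MulAut.mul_apply, ← pow_add, add_comm, pow_add, MulAut.mul_apply, hφ]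
  have hinv : ∀ i : ℕ, ∏ j ∈ Finset.range k, z ((σ ^ j) ((σ ^ i) φ)) =
      ∏ j ∈ Finset.range k, z ((σ ^ j) φ) := by
    intro i
    induction i with
    | zero => simp
    | succ i ih =>
      rw [← ih, ← hshiftA (fun j => z ((σ ^ j) ((σ ^ i) φ)))]
      · refine Finset.prod_congr rfl fun j _ => ?_
        simp only [← MulAut.mul_apply, ← pow_add]
        rw [add_assoc, add_comm 1 i]
      · simp [hfixpow]
  have hpow : ∀ m : ℕ, ∏ j ∈ Finset.range k, z ((σ ^ j) (∏ i ∈ Finset.range m, (σ ^ i) φ)) =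
      (∏ j ∈ Finset.range k, z ((σ ^ j) φ)) ^ m := by
    intro m
    induction m with
    | zero => simp [hfix 1 (map_one σ)]
    | succ m ih =>
      rw [Finset.prod_range_succ (fun i => (σ ^ i) φ), hmul _ _ _ (hfixpow m), ih, hinv, pow_succ]
      rw [map_prod]
      exact Finset.prod_congr rfl fun i _ => hfixpow i
  have hs : σ (∏ i ∈ Finset.range k, (σ ^ i) φ) = ∏ i ∈ Finset.range k, (σ ^ i) φ := by
    rw [map_prod, ← hshift (fun i => (σ ^ i) φ) (by simp [hφ])]
    exact Finset.prod_congr rfl fun i _ => by rw [pow_succ', MulAut.mul_apply]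
  rw [← hpow k]
  refine Finset.prod_eq_one fun j _ => ?_
  have hj : ∀ j : ℕ, (σ ^ j) (∏ i ∈ Finset.range k, (σ ^ i) φ) =
      ∏ i ∈ Finset.range k, (σ ^ i) φ := by
    intro j
    induction j with
    | zero => simp
    | succ j ih => rw [pow_succ, MulAut.mul_apply, hs, ih]
  rw [hj]
  exact hfix _ hs
end
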